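/- Let k ≥ 2, let a = (a_1,…,a_k) ∈ ℝ^k, and let x_1,…,x_{k−1} be arbitrary real numbers. Then a_1 + Σ_{s=1}^{k−1} a_{s+1}·w_{s,1}(x_1,…,x_s) = (2/3)·a_1 + (2/3)^{k−1}·a_k + Σ_{s=1}^{k−2} (2/3)^{s+1}·a_{s+1} + (1/3)·Σ_{ℓ=1}^{k−1} (2/3)^{ℓ−1}·θ_ℓ^k(x_ℓ,…,x_{k−1}; a). -/

import Mathlib

open Finset

/-- The 2×2 matrix `R(x)` with rows `(1−x, x)` and `(x, 1−x)`. -/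
noncomputable def Rm (x : ℝ) : Matrix (Fin 2) (Fin 2) ℝ := !![1 - x, x; x, 1 - x]

/-- The 2×2 matrix `T` with rows `(1, −1)` and `(0, 1)`. -/
noncomputable def Tm : Matrix (Fin 2) (Fin 2) ℝ := !![1, -1; 0, 1]

/-- Auxiliary product: `Maux x q n = R(x_{q+n})·T ⋯ R(x_q)·T`. -/
noncomputable def Maux (x : ℕ → ℝ) (q : ℕ) : ℕ → Matrix (Fin 2) (Fin 2) ℝ
  | 0 => Rm (x q) * Tm
  | n + 1 => Rm (x (q + n + 1)) * Tm * Maux x q n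

/-- `Mpq x p q = M_{p,q}(x_q,…,x_p) = R(x_p)·T·R(x_{p−1})·T ⋯ R(x_q)·T` (for `q ≤ p`). -/
noncomputable def Mpq (x : ℕ → ℝ) (p q : ℕ) : Matrix (Fin 2) (Fin 2) ℝ := Maux x q (p - q)

/-- `α_{p,q} = (M_{p,q})₂₂`. -/
noncomputable def alphaPQ (x : ℕ → ℝ) (p q : ℕ) : ℝ := Mpq x p q 1 1

/-- `β_{p,q} = (M_{p,q})₂₁`. -/
noncomputable def betaPQ (x : ℕ → ℝ) (p q : ℕ) : ℝ := Mpq x p q 1 0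

/-- `γ_{p,q} = (M_{p,q})₁₂`. -/
noncomputable def gammaPQ (x : ℕ → ℝ) (p q : ℕ) : ℝ := Mpq x p q 0 1

/-- `δ_{p,q} = (M_{p,q})₁₁`. -/
noncomputable def deltaPQ (x : ℕ → ℝ) (p q : ℕ) : ℝ := Mpq x p q 0 0

/-- `y_{p,q} = α_{p,q} − β_{p,q}`. -/
noncomputable def yPQ (x : ℕ → ℝ) (p q : ℕ) : ℝ := alphaPQ x p q - betaPQ x p q

/-- `w_{p,q} = α_{p,q} + β_{p,q}`. -/
noncomputable def wPQ (x : ℕ → ℝ) (p q : ℕ) : ℝ := alphaPQ x p q + betaPQ x p q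

/-- `θ_s^k(x_s,…,x_{k−1}; a) = a_s + Σ_{j=s}^{k−1} a_{j+1}·y_{j,s}`
(for `k = s` this is just `a_s`). -/
noncomputable def theta (x a : ℕ → ℝ) (k s : ℕ) : ℝ :=
  a s + ∑ j ∈ Finset.Icc s (k - 1), a (j + 1) * yPQ x j s

/-- Splitting off the rightmost factor of the matrix product. -/
lemma Maux_succ_right (x : ℕ → ℝ) (q n : ℕ) :
    Maux x q (n + 1) = Maux x (q + 1) n * (Rm (x q) * Tm) := by
  induction n with
  | zero => rfl
  | succ n ih =>
    rw [Maux, ih, Maux, Matrix.mul_assoc (Rm _ * Tm), show q + (n + 1) + 1 = q + 1 + n + 1 by ring]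

lemma Rm_mul_Tm (x : ℝ) : Rm x * Tm = !![1 - x, 2 * x - 1; x, 1 - 2 * x] := by
  ext i j
  fin_cases i <;> fin_cases j <;> simp [Rm, Tm, Matrix.mul_apply] <;> ring

lemma wPQ_self (x : ℕ → ℝ) (q : ℕ) : wPQ x q q = 2 / 3 + 1 / 3 * yPQ x q q := by
  simp [wPQ, yPQ, alphaPQ, betaPQ, Mpq, Maux, Rm_mul_Tm]
  ring

lemma wPQ_eq_of_lt (x : ℕ → ℝ) {p q : ℕ} (h : q < p) :
    wPQ x p q = 2 / 3 * wPQ x p (q + 1) + 1 / 3 * yPQ x p q := by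
  obtain ⟨n, rfl⟩ := Nat.exists_eq_add_of_lt h
  simp only [wPQ, yPQ, alphaPQ, betaPQ, Mpq, show q + n + 1 - q = n + 1 by omega,
    show q + n + 1 - (q + 1) = n by omega, Maux_succ_right, Rm_mul_Tm]
  simp [Matrix.mul_apply, Fin.sum_univ_two]
  ring

lemma wPQ_add_eq_sum (x : ℕ → ℝ) (q n : ℕ) :
    wPQ x (q + n) q = (2 / 3 : ℝ) ^ (n + 1)
      + 1 / 3 * ∑ i ∈ Finset.range (n + 1), (2 / 3 : ℝ) ^ i * yPQ x (q + n) (q + i) := by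
  induction n generalizing q with
  | zero => simp [wPQ_self]
  | succ n ih =>
    rw [wPQ_eq_of_lt x (by omega), show q + (n + 1) = q + 1 + n by ring, ih,
      Finset.sum_range_succ' _ (n + 1)]
    have hs : ∑ i ∈ Finset.range (n + 1), (2 / 3 : ℝ) ^ (i + 1) * yPQ x (q + 1 + n) (q + (i + 1))
        = 2 / 3 * ∑ i ∈ Finset.range (n + 1), (2 / 3 : ℝ) ^ i * yPQ x (q + 1 + n) (q + 1 + i) := by
      rw [Finset.mul_sum]
      refine Finset.sum_congr rfl fun i _ => ?_
      rw [show q + (i + 1) = q + 1 + i by ring]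
      ring
    rw [hs, add_zero]
    ring

lemma wPQ_one_eq_sum (x : ℕ → ℝ) (n : ℕ) :
    wPQ x (n + 1) 1 = (2 / 3 : ℝ) ^ (n + 1)
      + 1 / 3 * ∑ l ∈ Finset.Icc 1 (n + 1), (2 / 3 : ℝ) ^ (l - 1) * yPQ x (n + 1) l := by
  rw [add_comm n 1, wPQ_add_eq_sum, ← Finset.Ico_add_one_right_eq_Icc,
    Finset.sum_Ico_eq_sum_range, show 1 + n + 1 - 1 = n + 1 by omega, add_comm 1 n]
  simp

lemma theta_self (x a : ℕ → ℝ) (k : ℕ) : theta x a (k + 1) (k + 1) = a (k + 1) := by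
  simp [theta]

lemma theta_succ (x a : ℕ → ℝ) {k l : ℕ} (h : l ≤ k + 1) :
    theta x a (k + 2) l = theta x a (k + 1) l + a (k + 2) * yPQ x (k + 1) l := by
  simp only [theta, show k + 2 - 1 = k + 1 by omega, Nat.add_sub_cancel]
  rw [Finset.sum_Icc_succ_top h, ← add_assoc]

/-- Expansion of the trace term in the θ's:
`a_1 + Σ_{s=1}^{k−1} a_{s+1} w_{s,1} = (2/3)a_1 + (2/3)^{k−1}a_k + Σ_{s=1}^{k−2}(2/3)^{s+1}a_{s+1}
+ (1/3)Σ_{ℓ=1}^{k−1}(2/3)^{ℓ−1}θ_ℓ^k`. -/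
theorem stmt9 (k : ℕ) (hk : 2 ≤ k) (a x : ℕ → ℝ) :
    a 1 + ∑ s ∈ Finset.Icc 1 (k - 1), a (s + 1) * wPQ x s 1
      = (2 / 3) * a 1 + (2 / 3 : ℝ) ^ (k - 1) * a k
        + ∑ s ∈ Finset.Icc 1 (k - 2), (2 / 3 : ℝ) ^ (s + 1) * a (s + 1)
        + (1 / 3) * ∑ l ∈ Finset.Icc 1 (k - 1), (2 / 3 : ℝ) ^ (l - 1) * theta x a k l := by
  induction k, hk using Nat.le_induction with
  | base =>
    simp [theta, wPQ_self]
    ring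
  | succ k hk ih =>
    obtain ⟨m, rfl⟩ := Nat.exists_eq_add_of_le' hk
    have hθ : ∑ l ∈ Finset.Icc 1 (m + 2), (2 / 3 : ℝ) ^ (l - 1) * theta x a (m + 3) l
        = ∑ l ∈ Finset.Icc 1 (m + 2), (2 / 3 : ℝ) ^ (l - 1) * theta x a (m + 2) l
          + a (m + 3) * ∑ l ∈ Finset.Icc 1 (m + 2), (2 / 3 : ℝ) ^ (l - 1) * yPQ x (m + 2) l := by
      rw [Finset.mul_sum, ← Finset.sum_add_distrib]
      refine Finset.sum_congr rfl fun l hl => ?_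
      rw [theta_succ x a (Finset.mem_Icc.mp hl).2]
      ring
    have hlast : ∑ l ∈ Finset.Icc 1 (m + 2), (2 / 3 : ℝ) ^ (l - 1) * theta x a (m + 2) l
        = ∑ l ∈ Finset.Icc 1 (m + 1), (2 / 3 : ℝ) ^ (l - 1) * theta x a (m + 2) l
          + (2 / 3 : ℝ) ^ (m + 1) * a (m + 2) := by
      rw [Finset.sum_Icc_succ_top (by omega), theta_self, Nat.add_sub_cancel]
    simp only [show m + 2 - 1 = m + 1 by omega, Nat.add_sub_cancel] at ih
    simp only [show m + 2 + 1 - 1 = m + 2 by omega, show m + 2 + 1 - 2 = m + 1 by omega]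
    rw [Finset.sum_Icc_succ_top (by omega), ← add_assoc, ih, wPQ_one_eq_sum, hθ, hlast,
      Finset.sum_Icc_succ_top (b := m) (by omega) fun s => (2 / 3 : ℝ) ^ (s + 1) * a (s + 1)]
    ring
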